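/- arXiv:1406.5577 — 2 statements merged into one kernel-verified Lean document; each statement's English description precedes it below -/
import Mathlib

section
/- Let μ be a determinantal point process over 𝒴 = Fin N with real symmetric kernel K satisfying 0 ≺ K ≺ I, and let A and B be disjoint subsets of 𝒴. Then the events (A ⊆ Y) and (B ∩ Y = ∅) are independent, i.e. Pr(A ⊆ Y and B ∩ Y = ∅) = Pr(A ⊆ Y)·Pr(B ∩ Y = ∅), if and only if K_{A,B} = 0. -/
open Matrix BigOperators

/-- The submatrix of `K` with rows indexed by `A` and columns indexed by `B`. -/
def subm {N : ℕ} (K : Matrix (Fin N) (Fin N) ℝ) (A B : Finset (Fin N)) :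
    Matrix A B ℝ := fun i j => K i.1 j.1

open scoped Classical in
/-- The probability of the event `E` under the measure `μ`. -/
noncomputable def pr {N : ℕ} (μ : Finset (Fin N) → ℝ) (E : Finset (Fin N) → Prop) : ℝ :=
  ∑ S : Finset (Fin N), if E S then μ S else 0

/-- `μ` is a determinantal point process with kernel `K`. -/
noncomputable def IsDPP {N : ℕ} (μ : Finset (Fin N) → ℝ)
    (K : Matrix (Fin N) (Fin N) ℝ) : Prop :=
  (∀ S, 0 ≤ μ S) ∧ (∑ S : Finset (Fin N), μ S = 1) ∧
  ∀ A : Finset (Fin N), pr μ (fun S => A ⊆ S) = (subm K A A).det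

/-- The matrix whose rows are those of `K` on `A`, those of `1 - K` on `B \ A`, and those of `1`
elsewhere. -/
def mixedRows {N : ℕ} (K : Matrix (Fin N) (Fin N) ℝ) (A B : Finset (Fin N)) :
    Matrix (Fin N) (Fin N) ℝ :=
  fun i => if i ∈ A then K i else if i ∈ B then (1 - K) i else (1 : Matrix _ _ ℝ) i

theorem det_eq_det_submatrix_of_rows_eq_one {n : Type*} [Fintype n] [DecidableEq n]
    (M : Matrix n n ℝ) (A : Finset n) (h : ∀ i ∉ A, M i = (1 : Matrix n n ℝ) i) :
    M.det = (M.submatrix ((↑) : A → n) (↑)).det := by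
  rw [twoBlockTriangular_det M (· ∈ A)]
  · have h1 : M.toSquareBlockProp (· ∉ A) = 1 := by
      ext i j
      simp [toSquareBlockProp_def, h i.1 i.2, Matrix.one_apply, Subtype.val_inj]
    rw [h1, det_one, mul_one]
    convert! rfl
  · intro i hi j hj
    rw [h i hi, Matrix.one_apply_ne]
    rintro rfl
    exact hi hj

theorem det_mixedRows_insert {N : ℕ} (K : Matrix (Fin N) (Fin N) ℝ) {A B : Finset (Fin N)}
    {b : Fin N} (hA : b ∉ A) (hB : b ∉ B) :
    (mixedRows K A (insert b B)).det
      = (mixedRows K A B).det - (mixedRows K (insert b A) B).det := by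
  have h1 : mixedRows K A (insert b B)
      = (mixedRows K A B).updateRow b ((1 : Matrix _ _ ℝ) b + (-1 : ℝ) • K b) := by
    ext i j
    by_cases hi : i = b
    · subst hi
      simp [mixedRows, hA, sub_eq_add_neg]
    · simp [mixedRows, hi]
  have h2 : (mixedRows K A B).updateRow b ((1 : Matrix _ _ ℝ) b) = mixedRows K A B := by
    ext i j
    by_cases hi : i = b
    · subst hi
      simp [mixedRows, hA, hB]
    · simp [hi]
  have h3 : (mixedRows K A B).updateRow b (K b) = mixedRows K (insert b A) B := by
    ext i j
    by_cases hi : i = b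
    · subst hi
      simp [mixedRows]
    · simp [mixedRows, hi]
  rw [h1, det_updateRow_add, det_updateRow_smul, h2, h3]
  ring

theorem pr_avoid_insert {N : ℕ} (μ : Finset (Fin N) → ℝ) (A B : Finset (Fin N)) (b : Fin N) :
    pr μ (fun S => A ⊆ S ∧ insert b B ∩ S = ∅)
      = pr μ (fun S => A ⊆ S ∧ B ∩ S = ∅) - pr μ (fun S => insert b A ⊆ S ∧ B ∩ S = ∅) := by
  classical
  unfold pr
  rw [← Finset.sum_sub_distrib]
  refine Finset.sum_congr rfl fun S _ => ?_
  by_cases hb : b ∈ S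
  · simp only [Finset.insert_subset_iff, Finset.insert_inter_of_mem hb, hb, true_and,
      Finset.insert_ne_empty, and_false, if_false]
    split_ifs <;> simp
  · simp [Finset.insert_subset_iff, Finset.insert_inter_of_notMem, hb]

theorem pr_subset_avoid_eq_det_mixedRows {N : ℕ} {μ : Finset (Fin N) → ℝ}
    {K : Matrix (Fin N) (Fin N) ℝ} (hμ : IsDPP μ K) (A B : Finset (Fin N))
    (hAB : Disjoint A B) :
    pr μ (fun S => A ⊆ S ∧ B ∩ S = ∅) = (mixedRows K A B).det := by
  induction B using Finset.induction_on generalizing A with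
  | empty =>
    have h := hμ.2.2 A
    rw [det_eq_det_submatrix_of_rows_eq_one _ A]
    · simp only [Finset.empty_inter, and_true, h]
      congr 1
      ext i j
      simp [subm, mixedRows]
    · intro i hi
      simp [mixedRows, hi]
  | insert b B hb ih =>
    rw [Finset.disjoint_insert_right] at hAB
    rw [pr_avoid_insert, det_mixedRows_insert K hAB.1 hb, ih A hAB.2, ih (insert b A)]
    exact Finset.disjoint_insert_left.2 ⟨hb, hAB.2⟩

theorem det_mixedRows {N : ℕ} (K : Matrix (Fin N) (Fin N) ℝ) {A B : Finset (Fin N)}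
    (hAB : Disjoint A B) :
    (mixedRows K A B).det
      = (fromBlocks (subm K A A) (subm K A B) (-subm K B A) (1 - subm K B B)).det := by
  rw [det_eq_det_submatrix_of_rows_eq_one _ (A ∪ B),
    ← det_submatrix_equiv_self (Equiv.Finset.union A B hAB)]
  · congr 1
    ext i j
    rcases i with i | i <;> rcases j with j | j
    · simp [mixedRows, subm]
    · simp [mixedRows, subm]
    · have hi : i.1 ∉ A := fun h => Finset.disjoint_left.1 hAB h i.2
      have hij : i.1 ≠ j.1 := fun h => hi (h ▸ j.2)
      simp [mixedRows, subm, hi, Matrix.one_apply_ne hij]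
    · have hi : i.1 ∉ A := fun h => Finset.disjoint_left.1 hAB h i.2
      simp [mixedRows, subm, hi, Matrix.one_apply]
  · intro i hi
    rw [Finset.mem_union, not_or] at hi
    simp [mixedRows, hi.1, hi.2]

theorem pr_avoid_eq_det {N : ℕ} {μ : Finset (Fin N) → ℝ}
    {K : Matrix (Fin N) (Fin N) ℝ} (hμ : IsDPP μ K) (B : Finset (Fin N)) :
    pr μ (fun S => B ∩ S = ∅) = (1 - subm K B B).det := by
  have h := pr_subset_avoid_eq_det_mixedRows hμ ∅ B (Finset.disjoint_empty_left B)
  simp only [Finset.empty_subset, true_and] at h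
  rw [h, det_eq_det_submatrix_of_rows_eq_one _ B]
  · congr 1
    ext i j
    simp [mixedRows, subm, Matrix.one_apply]
  · intro i hi
    simp [mixedRows, hi]

theorem Matrix.PosSemidef.eq_zero_of_det_one_add_eq_one {n : Type*} [Fintype n] [DecidableEq n]
    {Q : Matrix n n ℝ} (hQ : Q.PosSemidef) (h : (1 + Q).det = 1) : Q = 0 := by
  have hdet : (1 + Q).det = ∏ i, (1 + hQ.1.eigenvalues i) := by
    have h1 : (1 + Q).det = (-1) ^ Fintype.card n * Q.charpoly.eval (-1) := by
      rw [eval_charpoly, ← det_neg]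
      congr 1
      ext i j
      simp [Matrix.scalar_apply, Matrix.one_apply, Matrix.diagonal_apply]
      split_ifs <;> ring
    rw [h1, hQ.1.charpoly_eq, Polynomial.eval_prod, ← Finset.card_univ, ← Finset.prod_const,
      ← Finset.prod_mul_distrib]
    refine Finset.prod_congr rfl fun i _ => ?_
    simp
    ring
  rw [← hQ.1.eigenvalues_eq_zero_iff]
  by_contra hne
  obtain ⟨i, hi⟩ := Function.ne_iff.1 hne
  have hpos : 0 < hQ.1.eigenvalues i := lt_of_le_of_ne (hQ.eigenvalues_nonneg i) (Ne.symm hi)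
  have hlt : ∏ j : n, (1 : ℝ) < ∏ j, (1 + hQ.1.eigenvalues j) :=
    Finset.prod_lt_prod (fun _ _ => one_pos)
      (fun j _ => le_add_of_nonneg_right (hQ.eigenvalues_nonneg j))
      ⟨i, Finset.mem_univ i, lt_add_of_pos_right 1 hpos⟩
  rw [← hdet, h, Finset.prod_const_one] at hlt
  exact hlt.false

open scoped MatrixOrder in
theorem Matrix.PosDef.exists_isUnit_eq_conjTranspose_mul_self {n : Type*} [Fintype n]
    [DecidableEq n] {M : Matrix n n ℝ} (hM : M.PosDef) :
    ∃ Y : Matrix n n ℝ, IsUnit Y ∧ M = Yᴴ * Y :=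
  CStarAlgebra.isStrictlyPositive_iff_eq_star_mul_self.mp hM.isStrictlyPositive

theorem Matrix.PosDef.eq_zero_of_det_add_eq {n : Type*} [Fintype n] [DecidableEq n]
    {M P : Matrix n n ℝ} (hM : M.PosDef) (hP : P.PosSemidef) (h : (M + P).det = M.det) :
    P = 0 := by
  obtain ⟨Y, hY, rfl⟩ := hM.exists_isUnit_eq_conjTranspose_mul_self
  have hYd : IsUnit Y.det := (isUnit_iff_isUnit_det Y).1 hY
  have hP' : P = Yᴴ * ((Y⁻¹)ᴴ * P * Y⁻¹) * Y := by
    have h1 : Yᴴ * (Y⁻¹)ᴴ = 1 := by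
      rw [← conjTranspose_mul, nonsing_inv_mul _ hYd, conjTranspose_one]
    simp only [← Matrix.mul_assoc, h1, Matrix.one_mul]
    rw [Matrix.mul_assoc, nonsing_inv_mul _ hYd, Matrix.mul_one]
  have hQ := hP.conjTranspose_mul_mul_same Y⁻¹
  have hsum : Yᴴ * Y + P = Yᴴ * (1 + (Y⁻¹)ᴴ * P * Y⁻¹) * Y := by
    rw [Matrix.mul_add, Matrix.add_mul, ← hP', Matrix.mul_one]
  have hdet : (1 + (Y⁻¹)ᴴ * P * Y⁻¹).det = 1 := by
    rw [hsum] at h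
    simp only [det_mul, det_conjTranspose, star_trivial] at h
    refine mul_left_cancel₀ (mul_ne_zero hYd.ne_zero hYd.ne_zero) ?_
    linear_combination h
  rw [hP', hQ.eq_zero_of_det_one_add_eq_one hdet, Matrix.mul_zero, Matrix.zero_mul]

theorem Matrix.PosDef.eq_zero_of_conjTranspose_mul_mul_eq_zero {m n : Type*} [Fintype m]
    [Fintype n] [DecidableEq m] {M : Matrix m m ℝ} (hM : M.PosDef) {C : Matrix m n ℝ}
    (h : Cᴴ * M * C = 0) : C = 0 := by
  obtain ⟨Y, hY, rfl⟩ := hM.exists_isUnit_eq_conjTranspose_mul_self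
  have hYd : IsUnit Y.det := (isUnit_iff_isUnit_det Y).1 hY
  have h1 : (Y * C)ᴴ * (Y * C) = 0 := by
    rw [← h, conjTranspose_mul]
    simp only [Matrix.mul_assoc]
  rw [← nonsing_inv_mul_cancel_left Y C hYd, conjTranspose_mul_self_eq_zero.1 h1, Matrix.mul_zero]

/-- For a DPP with kernel `0 ≺ K ≺ I` and disjoint `A`, `B`, the events `A ⊆ Y` and
`B ∩ Y = ∅` are independent iff `K_{A,B} = 0`. -/
theorem dpp_subset_avoid_independent_iff {N : ℕ} (μ : Finset (Fin N) → ℝ)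
    (K : Matrix (Fin N) (Fin N) ℝ) (hμ : IsDPP μ K) (hsymm : K.IsSymm)
    (hK : K.PosDef) (hKI : (1 - K).PosDef)
    (A B : Finset (Fin N)) (hAB : Disjoint A B) :
    pr μ (fun S => A ⊆ S ∧ B ∩ S = ∅)
      = pr μ (fun S => A ⊆ S) * pr μ (fun S => B ∩ S = ∅)
    ↔ subm K A B = 0 := by
  have hA : (subm K A A).PosDef := hK.submatrix Subtype.val_injective
  have hB : (1 - subm K B B).PosDef := by
    have h : 1 - subm K B B = (1 - K).submatrix ((↑) : B → Fin N) (↑) := by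
      ext i j
      simp [subm, Matrix.one_apply]
    exact h ▸ hKI.submatrix Subtype.val_injective
  have hBA : subm K B A = (subm K A B)ᴴ := by
    ext i j
    exact hsymm.apply j.1 i.1
  let : Invertible (subm K A A) := hA.isUnit.invertible
  rw [pr_subset_avoid_eq_det_mixedRows hμ A B hAB, det_mixedRows K hAB, hμ.2.2 A,
    pr_avoid_eq_det hμ B, det_fromBlocks₁₁, hBA, invOf_eq_nonsing_inv,
    mul_right_inj' hA.det_pos.ne', Matrix.neg_mul, Matrix.neg_mul, sub_neg_eq_add]
  constructor
  · intro h
    exact hA.inv.eq_zero_of_conjTranspose_mul_mul_eq_zero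
      (hB.eq_zero_of_det_add_eq (hA.inv.posSemidef.conjTranspose_mul_mul_same _) h)
  · intro h
    simp [h]
end

section
/- Let μ be a determinantal point process over 𝒴 = Fin N with real symmetric kernel K satisfying 0 ≺ K ≺ I, and let A, B, C be disjoint subsets of 𝒴 with C nonempty. Then the processes Y ∩ A and Y ∩ B are conditionally independent given the event (C ⊆ Y) — i.e. for all A₁ ⊆ A and B₁ ⊆ B, Pr(Y ∩ A = A₁ and Y ∩ B = B₁ and C ⊆ Y)·Pr(C ⊆ Y) = Pr(Y ∩ A = A₁ and C ⊆ Y)·Pr(Y ∩ B = B₁ and C ⊆ Y) — if and only if K^C_{A,B} = 0, i.e. K_{A,B} = K_{A,C} K_C⁻¹ K_{C,B}. -/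
open Matrix BigOperators

/-- The `A × B` block of the Schur complement `K^C = K_{Cᶜ} - K_{Cᶜ,C} K_C⁻¹ K_{C,Cᶜ}`,
i.e. `K_{A,B} - K_{A,C} K_C⁻¹ K_{C,B}` (for `A`, `B` disjoint from `C`). -/
noncomputable def schurBlock {N : ℕ} (K : Matrix (Fin N) (Fin N) ℝ)
    (C A B : Finset (Fin N)) : Matrix A B ℝ :=
  subm K A B - subm K A C * (subm K C C)⁻¹ * subm K C B

open scoped Classical in
/-- Summing over the possible values `X ⊇ U` of `Y ∩ A` gives the event `U ⊆ Y`. -/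
theorem sum_pr_inter_eq {N : ℕ} (μ : Finset (Fin N) → ℝ) (E : Finset (Fin N) → Prop)
    {U A : Finset (Fin N)} (hU : U ⊆ A) :
    ∑ X ∈ Finset.Icc U A, pr μ (fun S => S ∩ A = X ∧ E S) = pr μ (fun S => U ⊆ S ∧ E S) := by
  unfold pr
  rw [Finset.sum_comm]
  refine Finset.sum_congr rfl fun S _ => ?_
  by_cases hE : E S
  · simp [hE, Finset.sum_ite_eq, Finset.subset_inter_iff, hU]
  · simp [hE]

/-- If all sums of `g` over the intervals `[U, A]` vanish, then `g` vanishes below `A`. -/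
theorem eq_zero_of_sum_Icc_eq_zero {α : Type*} [Finite α] [DecidableEq α] {A : Finset α}
    {g : Finset α → ℝ} (h : ∀ U ⊆ A, ∑ X ∈ Finset.Icc U A, g X = 0) (U : Finset α) (hU : U ⊆ A) : g U = 0 := by
  induction U using WellFoundedGT.induction with
  | ind U ih =>
    rw [← h U hU, Finset.sum_eq_single U]
    · intro X hX hne
      rw [Finset.mem_Icc] at hX
      exact ih X (lt_of_le_of_ne hX.1 hne.symm) hX.2
    · simp [hU]

/-- Independence of `Y ∩ A` and `Y ∩ B` given `E` only has to be tested on the events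
`U ⊆ Y` and `V ⊆ Y` with `U ⊆ A` and `V ⊆ B`. -/
theorem pr_inter_independent_iff {N : ℕ} (μ : Finset (Fin N) → ℝ) (E : Finset (Fin N) → Prop)
    (A B : Finset (Fin N)) :
    (∀ A₁ ⊆ A, ∀ B₁ ⊆ B,
      pr μ (fun S => S ∩ A = A₁ ∧ S ∩ B = B₁ ∧ E S) * pr μ E
        = pr μ (fun S => S ∩ A = A₁ ∧ E S) * pr μ (fun S => S ∩ B = B₁ ∧ E S)) ↔
    ∀ U ⊆ A, ∀ V ⊆ B,
      pr μ (fun S => U ⊆ S ∧ V ⊆ S ∧ E S) * pr μ E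
        = pr μ (fun S => U ⊆ S ∧ E S) * pr μ (fun S => V ⊆ S ∧ E S) := by
  have hsum : ∀ U ⊆ A, ∀ V ⊆ B,
      ∑ X ∈ Finset.Icc U A, ∑ Z ∈ Finset.Icc V B,
        (pr μ (fun S => S ∩ A = X ∧ S ∩ B = Z ∧ E S) * pr μ E
          - pr μ (fun S => S ∩ A = X ∧ E S) * pr μ (fun S => S ∩ B = Z ∧ E S))
      = pr μ (fun S => U ⊆ S ∧ V ⊆ S ∧ E S) * pr μ E
        - pr μ (fun S => U ⊆ S ∧ E S) * pr μ (fun S => V ⊆ S ∧ E S) := by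
    intro U hU V hV
    simp_rw [Finset.sum_sub_distrib, ← Finset.mul_sum, ← Finset.sum_mul]
    rw [Finset.sum_comm]
    simp_rw [sum_pr_inter_eq μ _ hU, sum_pr_inter_eq μ _ hV, and_left_comm (a := U ⊆ _),
      sum_pr_inter_eq μ _ hV]
  constructor
  · intro h U hU V hV
    rw [← sub_eq_zero, ← hsum U hU V hV]
    refine Finset.sum_eq_zero fun X hX => Finset.sum_eq_zero fun Z hZ => ?_
    rw [sub_eq_zero]
    exact h X (Finset.mem_Icc.1 hX).2 Z (Finset.mem_Icc.1 hZ).2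
  · intro h A₁ hA₁ B₁ hB₁
    rw [← sub_eq_zero]
    refine eq_zero_of_sum_Icc_eq_zero (A := B) (g := fun Z =>
      pr μ (fun S => S ∩ A = A₁ ∧ S ∩ B = Z ∧ E S) * pr μ E
        - pr μ (fun S => S ∩ A = A₁ ∧ E S) * pr μ (fun S => S ∩ B = Z ∧ E S)) ?_ B₁ hB₁
    intro V hV
    refine eq_zero_of_sum_Icc_eq_zero (A := A) (g := fun X => ∑ Z ∈ Finset.Icc V B,
      (pr μ (fun S => S ∩ A = X ∧ S ∩ B = Z ∧ E S) * pr μ E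
        - pr μ (fun S => S ∩ A = X ∧ E S) * pr μ (fun S => S ∩ B = Z ∧ E S))) ?_ A₁ hA₁
    intro U hU
    rw [hsum U hU V hV, h U hU V hV, sub_self]

theorem det_subm_union {N : ℕ} (K : Matrix (Fin N) (Fin N) ℝ) {X Z : Finset (Fin N)}
    (h : Disjoint X Z) :
    (subm K (X ∪ Z) (X ∪ Z)).det
      = (fromBlocks (subm K X X) (subm K X Z) (subm K Z X) (subm K Z Z)).det := by
  rw [← det_submatrix_equiv_self (Equiv.Finset.union X Z h)]
  congr 1
  ext (i | i) (j | j) <;> simp [subm]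

theorem det_subm_union_eq_mul_schurBlock {N : ℕ} {K : Matrix (Fin N) (Fin N) ℝ}
    {X C : Finset (Fin N)} (h : Disjoint X C) (hC : (subm K C C).det ≠ 0) :
    (subm K (X ∪ C) (X ∪ C)).det = (subm K C C).det * (schurBlock K C X X).det := by
  have := invertibleOfIsUnitDet (subm K C C) hC.isUnit
  rw [det_subm_union K h, det_fromBlocks₂₂, invOf_eq_nonsing_inv, schurBlock]

theorem det_subm_pair {N : ℕ} (K : Matrix (Fin N) (Fin N) ℝ) {a b : Fin N} (h : a ≠ b) :
    (subm K ({a} ∪ {b}) ({a} ∪ {b})).det = K a a * K b b - K a b * K b a := by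
  let f : Fin 2 → ({a} ∪ {b} : Finset (Fin N)) := ![⟨a, by simp⟩, ⟨b, by simp⟩]
  have hf : Function.Bijective f := by
    constructor
    · intro i j hij
      fin_cases i <;> fin_cases j <;> simp_all [f, Subtype.ext_iff, h.symm]
    · rintro ⟨x, hx⟩
      rcases Finset.mem_union.1 hx with hx | hx
      · exact ⟨0, by simp_all [f]⟩
      · exact ⟨1, by simp_all [f]⟩
  rw [← det_submatrix_equiv_self (Equiv.ofBijective f hf), det_fin_two]
  rfl

theorem det_subm_singleton {N : ℕ} (K : Matrix (Fin N) (Fin N) ℝ) (a : Fin N) :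
    (subm K {a} {a}).det = K a a := by
  rw [det_unique]
  rfl

/-- The matrix on the whole ground set whose blocks are the Schur complement blocks of `K`. -/
noncomputable def schurMatrix {N : ℕ} (K : Matrix (Fin N) (Fin N) ℝ) (C : Finset (Fin N)) :
    Matrix (Fin N) (Fin N) ℝ :=
  fun i j => schurBlock K C {i} {j} ⟨i, by simp⟩ ⟨j, by simp⟩

theorem schurBlock_eq_subm {N : ℕ} (K : Matrix (Fin N) (Fin N) ℝ) (C X Z : Finset (Fin N)) :
    schurBlock K C X Z = subm (schurMatrix K C) X Z :=
  rfl

theorem schurMatrix_isSymm {N : ℕ} {K : Matrix (Fin N) (Fin N) ℝ} (hK : K.IsSymm)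
    (C : Finset (Fin N)) : (schurMatrix K C).IsSymm := by
  have ht : ∀ X Z : Finset (Fin N), (subm K X Z)ᵀ = subm K Z X := fun X Z => by
    ext i j
    exact hK.apply _ _
  ext i j
  have h : (schurBlock K C {i} {j})ᵀ = schurBlock K C {j} {i} := by
    simp [schurBlock, transpose_nonsing_inv, ht, Matrix.mul_assoc]
  exact congrFun (congrFun h.symm ⟨j, by simp⟩) ⟨i, by simp⟩

theorem PosDef.det_subm_pos {N : ℕ} {K : Matrix (Fin N) (Fin N) ℝ} (hK : K.PosDef)
    (C : Finset (Fin N)) : 0 < (subm K C C).det :=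
  (hK.submatrix (e := ((↑) : C → Fin N)) Subtype.val_injective).det_pos

/-- For a DPP with kernel `0 ≺ K ≺ I` and disjoint `A`, `B`, `C` with `C` nonempty,
the processes `Y ∩ A` and `Y ∩ B` are conditionally independent given `C ⊆ Y` iff
`K^C_{A,B} = 0`, i.e. `K_{A,B} = K_{A,C} K_C⁻¹ K_{C,B}`. -/
theorem dpp_restrict_cond_independent_iff {N : ℕ} (μ : Finset (Fin N) → ℝ)
    (K : Matrix (Fin N) (Fin N) ℝ) (hμ : IsDPP μ K) (hsymm : K.IsSymm)
    (hK : K.PosDef) (hKI : (1 - K).PosDef)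
    (A B C : Finset (Fin N)) (hAB : Disjoint A B) (hAC : Disjoint A C)
    (hBC : Disjoint B C) (hCne : C.Nonempty) :
    (∀ A₁ ⊆ A, ∀ B₁ ⊆ B,
      pr μ (fun S => S ∩ A = A₁ ∧ S ∩ B = B₁ ∧ C ⊆ S) * pr μ (fun S => C ⊆ S)
        = pr μ (fun S => S ∩ A = A₁ ∧ C ⊆ S) * pr μ (fun S => S ∩ B = B₁ ∧ C ⊆ S))
    ↔ schurBlock K C A B = 0 := by
  have hC : (subm K C C).det ≠ 0 := (PosDef.det_subm_pos hK C).ne'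
  have hpr : ∀ X, Disjoint X C → pr μ (fun S => X ⊆ S ∧ C ⊆ S)
      = (subm K C C).det * (subm (schurMatrix K C) X X).det := fun X hX => by
    simp_rw [← Finset.union_subset_iff]
    rw [hμ.2.2, det_subm_union_eq_mul_schurBlock hX hC, schurBlock_eq_subm]
  rw [pr_inter_independent_iff, hμ.2.2, schurBlock_eq_subm]
  set L := schurMatrix K C
  have hpair : ∀ U ⊆ A, ∀ V ⊆ B, pr μ (fun S => U ⊆ S ∧ V ⊆ S ∧ C ⊆ S)
      = (subm K C C).det * (subm L (U ∪ V) (U ∪ V)).det := fun U hU V hV => by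
    rw [← hpr _ (Finset.disjoint_union_left.2 ⟨hAC.mono_left hU, hBC.mono_left hV⟩)]
    simp only [Finset.union_subset_iff, and_assoc]
  have hiff : ∀ U ⊆ A, ∀ V ⊆ B,
      (pr μ (fun S => U ⊆ S ∧ V ⊆ S ∧ C ⊆ S) * (subm K C C).det
        = pr μ (fun S => U ⊆ S ∧ C ⊆ S) * pr μ (fun S => V ⊆ S ∧ C ⊆ S)) ↔
      (subm L (U ∪ V) (U ∪ V)).det = (subm L U U).det * (subm L V V).det := fun U hU V hV => by
    rw [hpair U hU V hV, hpr U (hAC.mono_left hU), hpr V (hBC.mono_left hV),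
      mul_right_comm, mul_mul_mul_comm, mul_right_inj' (mul_ne_zero hC hC)]
  have hL : L.IsSymm := schurMatrix_isSymm hsymm C
  constructor
  · intro h
    ext ⟨a, ha⟩ ⟨b, hb⟩
    have ha' := Finset.singleton_subset_iff.2 ha
    have hb' := Finset.singleton_subset_iff.2 hb
    have hab := (hiff _ ha' _ hb').1 (h _ ha' _ hb')
    rw [det_subm_pair L (hAB.forall_ne_finset ha hb),
      det_subm_singleton, det_subm_singleton, hL.apply a b, sub_eq_self, mul_self_eq_zero] at hab
    exact hab
  · intro h U hU V hV
    have h0 : ∀ a ∈ A, ∀ b ∈ B, L a b = 0 := fun a ha b hb =>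
      congrFun (congrFun h ⟨a, ha⟩) ⟨b, hb⟩
    have hUV : subm L U V = 0 := by
      ext i j
      exact h0 _ (hU i.2) _ (hV j.2)
    rw [hiff U hU V hV, det_subm_union L (hAB.mono hU hV), hUV, det_fromBlocks_zero₁₂]
end
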